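/- The number of closed walks of length 2k on the infinite (d1,d2)-biregular tree that start and end at a root of degree d1, never immediately backtrack at even depths (i.e., after moving from a V1-vertex to a V2-vertex the walk does not return to the same V1-vertex), use exactly k/2+1 distinct V1-vertices and k/2 distinct V2-vertices (k even), satisfies (d1 - k/2 - 1)^{k/2} (d2-1)^{k/2} · Cat(k/2) ≤ A_k^{k/2+1, k/2} ≤ d1^{k/2} (d2-1)^{k/2} · Cat(k/2), where Cat(j) is the j-th Catalan number. -/

import Mathlib

/-- Vertices of the infinite (d1,d2)-biregular tree, encoded as paths from the root:
a vertex is a list `[a_ℓ, …, a_2, a_1]` of child indices, where the choice at the root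
(position `0` from the root) lies in `Fin d1`, the choices at subsequent even-depth
(V2) vertices lie in `Fin (d2 - 1)` and those at odd-depth (V1) vertices in
`Fin (d1 - 1)`. The root (degree `d1`, a V1-vertex) is `[]`; even-length lists are
V1-vertices and odd-length lists are V2-vertices. -/
def okList (d1 d2 : ℕ) (l : List ℕ) : Prop :=
  ∀ (i : ℕ) (h : i < l.length),
    l.reverse.get ⟨i, by simpa using h⟩ <
      (if i = 0 then d1 else if i % 2 = 1 then d2 - 1 else d1 - 1)

namespace BT

theorem ok_nil (d1 d2 : ℕ) : okList d1 d2 [] := by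
  intro i h; simp at h

theorem ok_cons (d1 d2 a : ℕ) (l : List ℕ) :
    okList d1 d2 (a :: l) ↔ okList d1 d2 l ∧
      a < (if l.length = 0 then d1 else if l.length % 2 = 1 then d2 - 1 else d1 - 1) := by
  constructor
  · intro h
    refine ⟨?_, ?_⟩
    · intro i hi
      have := h i (by simp; omega)
      simpa [List.getElem_append, hi] using this
    · have := h l.length (by simp)
      simpa using this
  · rintro ⟨h1, h2⟩ i hi
    by_cases hil : i < l.length
    · have := h1 i hil
      simpa [List.getElem_append, hil] using this
    · have : i = l.length := by simp at hi; omega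
      subst this
      simpa using h2

/-- positions of the walk at even times, driven by instructions -/
def pos (f : ℕ → Option (ℕ × ℕ)) : ℕ → List ℕ
  | 0 => []
  | s + 1 => match f s with
    | none => (pos f s).tail.tail
    | some ab => ab.2 :: ab.1 :: pos f s

/-- positions at odd times -/
def mid (f : ℕ → Option (ℕ × ℕ)) (s : ℕ) : List ℕ :=
  match f s with
    | none => (pos f s).tail
    | some ab => ab.1 :: pos f s

/-- full walk -/
def full (f : ℕ → Option (ℕ × ℕ)) (t : ℕ) : List ℕ :=
  if t % 2 = 0 then pos f (t / 2) else mid f (t / 2)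

/-- number of up steps before s -/
def upc (f : ℕ → Option (ℕ × ℕ)) (s : ℕ) : ℕ :=
  ((Finset.range s).filter (fun i => (f i).isSome = true)).card

theorem pos_none {f : ℕ → Option (ℕ × ℕ)} {s : ℕ} (h : f s = none) :
    pos f (s + 1) = (pos f s).tail.tail := by simp [pos, h]
theorem pos_some {f : ℕ → Option (ℕ × ℕ)} {s : ℕ} {ab : ℕ × ℕ} (h : f s = some ab) :
    pos f (s + 1) = ab.2 :: ab.1 :: pos f s := by simp [pos, h]
theorem mid_none {f : ℕ → Option (ℕ × ℕ)} {s : ℕ} (h : f s = none) :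
    mid f s = (pos f s).tail := by simp [mid, h]
theorem mid_some {f : ℕ → Option (ℕ × ℕ)} {s : ℕ} {ab : ℕ × ℕ} (h : f s = some ab) :
    mid f s = ab.1 :: pos f s := by simp [mid, h]
theorem full_even (f : ℕ → Option (ℕ × ℕ)) (s : ℕ) : full f (2 * s) = pos f s := by
  simp [full]
theorem full_odd (f : ℕ → Option (ℕ × ℕ)) (s : ℕ) : full f (2 * s + 1) = mid f s := by
  have : (2 * s + 1) / 2 = s := by omega
  simp [full, this]

theorem upc_none {f : ℕ → Option (ℕ × ℕ)} {s : ℕ} (h : f s = none) :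
    upc f (s + 1) = upc f s := by
  simp [upc, Finset.range_add_one, Finset.filter_insert, h]
theorem upc_some {f : ℕ → Option (ℕ × ℕ)} {s : ℕ} {ab : ℕ × ℕ} (h : f s = some ab) :
    upc f (s + 1) = upc f s + 1 := by
  simp [upc, Finset.range_add_one, Finset.filter_insert, h]

/-- lengths of positions, under the Dyck condition -/
theorem len_pos {f : ℕ → Option (ℕ × ℕ)} {n : ℕ} (hD : ∀ s ≤ n, s ≤ 2 * upc f s) :
    ∀ s ≤ n, (pos f s).length + 2 * s = 4 * upc f s := by
  intro s
  induction s with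
  | zero => intro _; simp [pos, upc]
  | succ s ih =>
    intro hs
    have h1 := ih (by omega)
    have h2 := hD (s + 1) hs
    rcases hf : f s with _ | ab
    · rw [upc_none hf] at h2 ⊢
      rw [pos_none hf]
      simp
      omega
    · rw [upc_some hf] at h2 ⊢
      rw [pos_some hf]
      simp
      omega

theorem two_le {f : ℕ → Option (ℕ × ℕ)} {n : ℕ} (hD : ∀ s ≤ n, s ≤ 2 * upc f s)
    {s : ℕ} (hs : s < n) (hf : f s = none) : ∃ b a l, pos f s = b :: a :: l := by
  have h1 := len_pos hD s (by omega)
  have h2 := hD (s + 1) hs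
  rw [upc_none hf] at h2
  rcases hp : pos f s with _ | ⟨b, _ | ⟨a, l⟩⟩
  · simp [hp] at h1; omega
  · simp [hp] at h1; omega
  · exact ⟨_, _, _, rfl⟩

theorem pos_mem {f : ℕ → Option (ℕ × ℕ)} {n : ℕ} (hD : ∀ s ≤ n, s ≤ 2 * upc f s) :
    ∀ s ≤ n, pos f s = [] ∨ ∃ i < s, ∃ ab, f i = some ab ∧ pos f s = pos f (i + 1) := by
  intro s
  induction s using Nat.strong_induction_on with
  | _ s ih =>
    intro hs
    rcases s with _ | s
    · left; rfl
    rcases hf : f s with _ | ab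
    · obtain ⟨b, a, l, hl⟩ := two_le hD (by omega) hf
      rcases ih s (by omega) (by omega) with h | ⟨i, hi, ab, h1, h2⟩
      · simp [h] at hl
      · have : pos f (s + 1) = pos f i := by
          rw [pos_none hf, h2, pos_some h1]; rfl
        rw [this]
        rcases ih i (by omega) (by omega) with h | ⟨i', hi', h⟩
        · left; exact h
        · right; exact ⟨i', by omega, h⟩
    · right; exact ⟨s, by omega, ab, hf, rfl⟩

theorem mid_mem {f : ℕ → Option (ℕ × ℕ)} {n : ℕ} (hD : ∀ s ≤ n, s ≤ 2 * upc f s)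
    (s : ℕ) (hs : s < n) : ∃ i < n, ∃ ab, f i = some ab ∧ mid f s = mid f i := by
  rcases hf : f s with _ | ab
  · obtain ⟨b, a, l, hl⟩ := two_le hD hs hf
    rcases pos_mem hD s (by omega) with h | ⟨i, hi, ab, h1, h2⟩
    · simp [h] at hl
    · refine ⟨i, by omega, ab, h1, ?_⟩
      rw [mid_none hf, mid_some h1, h2, pos_some h1]; rfl
  · exact ⟨s, hs, ab, hf, rfl⟩

/-- the property of walks, for functions on ℕ -/
def Good (d1 d2 j : ℕ) (W : ℕ → List ℕ) : Prop :=
  (∀ t ≤ 4 * j, okList d1 d2 (W t)) ∧ W 0 = [] ∧ W (4 * j) = [] ∧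
  (∀ t < 4 * j, (∃ a, W (t + 1) = a :: W t) ∨ (∃ a, W t = a :: W (t + 1))) ∧
  (∀ t, t + 2 ≤ 4 * j → t % 2 = 0 → W (t + 2) ≠ W t) ∧
  ((Finset.range (2 * j + 1)).image (fun s => W (2 * s))).card = j + 1 ∧
  ((Finset.range (2 * j)).image (fun s => W (2 * s + 1))).card = j

theorem ok_tail {d1 d2 : ℕ} {l : List ℕ} (h : okList d1 d2 l) : okList d1 d2 l.tail := by
  cases l with
  | nil => exact h
  | cons a l => exact ((ok_cons _ _ _ _).1 h).1

theorem len_even (f : ℕ → Option (ℕ × ℕ)) (s : ℕ) : (pos f s).length % 2 = 0 := by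
  induction s with
  | zero => rfl
  | succ s ih =>
    rcases hf : f s with _ | ab
    · rw [pos_none hf]; simp; omega
    · rw [pos_some hf]; simp; omega

theorem ok_mid {d1 d2 : ℕ} {f : ℕ → Option (ℕ × ℕ)}
    (hl : ∀ s ab, f s = some ab → ab.1 < d1 - 1 ∧ ab.2 < d2 - 1) {s : ℕ}
    (h : okList d1 d2 (pos f s)) : okList d1 d2 (mid f s) := by
  have := len_even f s
  rcases hf : f s with _ | ab
  · rw [mid_none hf]; exact ok_tail h
  · rw [mid_some hf, ok_cons]
    refine ⟨h, ?_⟩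
    have := hl s ab hf
    split_ifs <;> omega

theorem ok_pos {d1 d2 : ℕ} {f : ℕ → Option (ℕ × ℕ)}
    (hl : ∀ s ab, f s = some ab → ab.1 < d1 - 1 ∧ ab.2 < d2 - 1) (s : ℕ) :
    okList d1 d2 (pos f s) := by
  induction s with
  | zero => exact ok_nil _ _
  | succ s ih =>
    have := len_even f s
    have hm := ok_mid hl ih
    rcases hf : f s with _ | ab
    · rw [pos_none hf]; exact ok_tail (ok_tail ih)
    · rw [mid_some hf] at hm
      rw [pos_some hf, ok_cons]
      refine ⟨hm, ?_⟩
      have := hl s ab hf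
      rw [List.length_cons, if_neg (by omega), if_pos (by omega)]
      exact this.2

theorem good_full {d1 d2 j : ℕ} {f : ℕ → Option (ℕ × ℕ)}
    (hl : ∀ s ab, f s = some ab → ab.1 < d1 - 1 ∧ ab.2 < d2 - 1)
    (hinj : ∀ s s' ab ab', f s = some ab → f s' = some ab' → ab.1 = ab'.1 → s = s')
    (hD : ∀ s ≤ 2 * j, s ≤ 2 * upc f s) (hj : upc f (2 * j) = j) :
    Good d1 d2 j (full f) := by
  have hlen := len_pos hD
  refine ⟨?_, rfl, ?_, ?_, ?_, ?_, ?_⟩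
  · intro t _
    unfold full
    split_ifs
    · exact ok_pos hl _
    · exact ok_mid hl (ok_pos hl _)
  · have := hlen (2 * j) le_rfl
    rw [show 4 * j = 2 * (2 * j) by ring, full_even]
    rw [← List.length_eq_zero_iff]; omega
  · intro t ht
    rcases Nat.even_or_odd' t with ⟨s, rfl | rfl⟩
    · rw [full_even, full_odd]
      rcases hf : f s with _ | ab
      · obtain ⟨b, a, l, h⟩ := two_le hD (by omega) hf
        right; rw [mid_none hf, h]; exact ⟨b, rfl⟩
      · left; rw [mid_some hf]; exact ⟨_, rfl⟩
    · rw [show 2 * s + 1 + 1 = 2 * (s + 1) by ring, full_even, full_odd]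
      rcases hf : f s with _ | ab
      · obtain ⟨b, a, l, h⟩ := two_le hD (by omega) hf
        right; rw [mid_none hf, pos_none hf, h]; exact ⟨a, rfl⟩
      · left; rw [mid_some hf, pos_some hf]; exact ⟨_, rfl⟩
  · intro t ht h2 h
    obtain ⟨s, rfl⟩ : ∃ s, t = 2 * s := ⟨t / 2, by omega⟩
    rw [show 2 * s + 2 = 2 * (s + 1) by ring, full_even, full_even] at h
    have h1 := hlen s (by omega)
    have h3 := hlen (s + 1) (by omega)
    rw [h] at h3
    omega
  · have : (Finset.range (2 * j + 1)).image (fun s => full f (2 * s)) =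
        insert [] (((Finset.range (2 * j)).filter (fun i => (f i).isSome = true)).image
          (fun s => pos f (s + 1))) := by
      ext x
      simp only [Finset.mem_image, Finset.mem_range, Finset.mem_insert, Finset.mem_filter,
        full_even]
      constructor
      · rintro ⟨s, hs, rfl⟩
        rcases pos_mem hD s (by omega) with h | ⟨i, hi, ab, h1, h2⟩
        · left; exact h
        · right; exact ⟨i, ⟨by omega, by simp [h1]⟩, h2.symm⟩
      · rintro (rfl | ⟨s, ⟨hs, _⟩, rfl⟩)
        · exact ⟨0, by omega, rfl⟩
        · exact ⟨s + 1, by omega, rfl⟩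
    rw [this, Finset.card_insert_of_notMem, Finset.card_image_of_injOn]
    · change upc f (2 * j) + 1 = _
      rw [hj]
    · intro s hs s' hs' h
      simp only [Finset.coe_filter, Set.mem_ofPred_eq, Option.isSome_iff_exists] at hs hs'
      obtain ⟨_, ab, h1⟩ := hs
      obtain ⟨_, ab', h1'⟩ := hs'
      simp only [pos_some h1, pos_some h1', List.cons.injEq] at h
      exact hinj _ _ _ _ h1 h1' h.2.1
    · simp only [Finset.mem_image, Finset.mem_filter, Option.isSome_iff_exists]
      rintro ⟨s, ⟨_, ab, h1⟩, h⟩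
      rw [pos_some h1] at h
      simp at h
  · have : (Finset.range (2 * j)).image (fun s => full f (2 * s + 1)) =
        (((Finset.range (2 * j)).filter (fun i => (f i).isSome = true)).image
          (fun s => mid f s)) := by
      ext x
      simp only [Finset.mem_image, Finset.mem_range, Finset.mem_filter, full_odd]
      constructor
      · rintro ⟨s, hs, rfl⟩
        obtain ⟨i, hi, ab, h1, h2⟩ := mid_mem hD s (by omega)
        exact ⟨i, ⟨by omega, by simp [h1]⟩, h2.symm⟩
      · rintro ⟨s, ⟨hs, _⟩, rfl⟩
        exact ⟨s, by omega, rfl⟩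
    rw [this, Finset.card_image_of_injOn]
    · exact hj
    · intro s hs s' hs' h
      simp only [Finset.coe_filter, Set.mem_ofPred_eq, Option.isSome_iff_exists] at hs hs'
      obtain ⟨_, ab, h1⟩ := hs
      obtain ⟨_, ab', h1'⟩ := hs'
      simp only [mid_some h1, mid_some h1', List.cons.injEq] at h
      exact hinj _ _ _ _ h1 h1' h.1

theorem full_inj {f g : ℕ → Option (ℕ × ℕ)} {n : ℕ}
    (h : ∀ t ≤ 2 * n, full f t = full g t) : ∀ s < n, f s = g s := by
  intro s hs
  have h1 := h (2 * s) (by omega)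
  have h2 := h (2 * (s + 1)) (by omega)
  rw [full_even, full_even] at h1 h2
  rcases hf : f s with _ | ab <;> rcases hg : g s with _ | cd
  · rfl
  · rw [pos_none hf, pos_some hg, h1] at h2
    have := congrArg List.length h2
    simp at this; omega
  · rw [pos_some hf, pos_none hg, h1] at h2
    have := congrArg List.length h2
    simp at this; omega
  · rw [pos_some hf, pos_some hg] at h2
    simp only [List.cons.injEq] at h2
    rw [Prod.ext h2.2.1 h2.1]

/-- Every walk comes from instructions. -/
theorem exists_instr {d1 d2 j : ℕ} {W : ℕ → List ℕ} (hW : Good d1 d2 j W) :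
    ∃ f : ℕ → Option (ℕ × ℕ),
      (∀ s ab, s < 2 * j → f s = some ab → ab.1 < d1 ∧ ab.2 < d2 - 1) ∧
      (∀ s ≤ 2 * j, s ≤ 2 * upc f s) ∧ upc f (2 * j) = j ∧
      (∀ t ≤ 4 * j, W t = full f t) := by
  obtain ⟨hok, h0, hend, hadj, hnb, hc1, hc2⟩ := hW
  have hpar : ∀ t ≤ 4 * j, (W t).length % 2 = t % 2 := by
    intro t
    induction t with
    | zero => simp [h0]
    | succ t ih =>
      intro ht
      have := ih (by omega)
      rcases hadj t (by omega) with ⟨a, h⟩ | ⟨a, h⟩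
      · rw [h]; simp; omega
      · rw [h] at this; simp at this; omega
  have hfirst : ∀ t ≤ 4 * j, ∀ x, x ≠ [] → x <:+ W t →
      ∃ t' < t, W (t' + 1) = x ∧ ∃ a, x = a :: W t' := by
    intro t
    induction t with
    | zero => intro _ x hx hs; rw [h0] at hs; simp at hs; exact absurd hs hx
    | succ t ih =>
      intro ht x hx hs
      have key : x <:+ W t → ∃ t' < t + 1, W (t' + 1) = x ∧ ∃ a, x = a :: W t' := by
        intro h
        obtain ⟨t', h1, h2⟩ := ih (by omega) x hx h
        exact ⟨t', by omega, h2⟩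
      rcases hadj t (by omega) with ⟨a, h⟩ | ⟨a, h⟩
      · rw [h, List.suffix_cons_iff] at hs
        rcases hs with hs | hs
        · exact ⟨t, by omega, by rw [h, hs], a, hs⟩
        · exact key hs
      · apply key
        rw [h]
        exact hs.trans (List.suffix_cons _ _)
  classical
  obtain ⟨UP, hUPd⟩ : ∃ UP : ℕ → Prop, ∀ t, UP t ↔ W (t + 1) = (W (t + 1)).headD 0 :: W t :=
    ⟨_, fun t => Iff.rfl⟩
  have hUP : ∀ t a, W (t + 1) = a :: W t → UP t := by
    intro t a h; rw [hUPd, h]; rfl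
  have hDN : ∀ t < 4 * j, ¬ UP t → ∃ a, W t = a :: W (t + 1) := by
    intro t ht h
    rcases hadj t ht with ⟨a, h'⟩ | h'
    · exact absurd (hUP t a h') h
    · exact h'
  have hlen : ∀ s ≤ 2 * j, (W (2 * s)).length + 2 * s =
      2 * (((Finset.range s).filter (fun s => UP (2 * s))).card +
        ((Finset.range s).filter (fun s => UP (2 * s + 1))).card) := by
    have step : ∀ t < 4 * j, (W (t + 1)).length + 1 = (W t).length + if UP t then 2 else 0 := by
      intro t ht
      split_ifs with h
      · have := congrArg List.length ((hUPd t).1 h)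
        simp only [List.length_cons] at this; omega
      · obtain ⟨a, h⟩ := hDN t ht h
        rw [h]; simp
    intro s
    induction s with
    | zero => simp [h0]
    | succ s ih =>
      intro hs
      have e1 := ih (by omega)
      have e2 := step (2 * s) (by omega)
      have e3 := step (2 * s + 1) (by omega)
      rw [show 2 * s + 1 + 1 = 2 * (s + 1) by ring] at e3
      rw [Finset.range_add_one, Finset.filter_insert, Finset.filter_insert]
      by_cases u1 : UP (2 * s) <;> by_cases u2 : UP (2 * s + 1) <;>
        simp only [u1, u2, if_true, if_false] at e2 e3 ⊢ <;>
        (try simp) <;> omega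
  set E := (Finset.range (2 * j)).filter (fun s => UP (2 * s)) with hE
  set O := (Finset.range (2 * j)).filter (fun s => UP (2 * s + 1)) with hO
  have hEO : E.card + O.card = 2 * j := by
    have : (W (2 * (2 * j))).length + 2 * (2 * j) = 2 * (E.card + O.card) := hlen (2 * j) le_rfl
    rw [show 2 * (2 * j) = 4 * j by ring, hend] at this
    simp only [List.length_nil] at this
    omega
  have hEj : j ≤ E.card := by
    have : (Finset.range (2 * j)).image (fun s => W (2 * s + 1)) ⊆
        E.image (fun s => W (2 * s + 1)) := by
      intro x hx
      simp only [Finset.mem_image, Finset.mem_range] at hx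
      obtain ⟨s, hs, rfl⟩ := hx
      have hp := hpar (2 * s + 1) (by omega)
      obtain ⟨t', h1, h2, a, h3⟩ := hfirst (2 * s + 1) (by omega) (W (2 * s + 1))
        (by intro h; rw [h] at hp; simp at hp) List.suffix_rfl
      have hp' := hpar (t' + 1) (by omega)
      rw [h2] at hp'
      obtain ⟨r, rfl⟩ : ∃ r, t' = 2 * r := ⟨t' / 2, by omega⟩
      simp only [Finset.mem_image, hE, Finset.mem_filter, Finset.mem_range]
      exact ⟨r, ⟨by omega, hUP _ a (by rw [h2, h3])⟩, h2⟩
    have := (Finset.card_le_card this).trans Finset.card_image_le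
    omega
  have hOj : j ≤ O.card := by
    have : (Finset.range (2 * j + 1)).image (fun s => W (2 * s)) ⊆
        insert [] (O.image (fun s => W (2 * s + 2))) := by
      intro x hx
      simp only [Finset.mem_image, Finset.mem_range] at hx
      obtain ⟨s, hs, rfl⟩ := hx
      rw [Finset.mem_insert]
      by_cases hn : W (2 * s) = []
      · left; exact hn
      right
      have hp := hpar (2 * s) (by omega)
      obtain ⟨t', h1, h2, a, h3⟩ := hfirst (2 * s) (by omega) (W (2 * s)) hn List.suffix_rfl
      have hp' := hpar (t' + 1) (by omega)
      rw [h2] at hp'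
      obtain ⟨r, rfl⟩ : ∃ r, t' = 2 * r + 1 := ⟨t' / 2, by omega⟩
      simp only [Finset.mem_image, hO, Finset.mem_filter, Finset.mem_range]
      exact ⟨r, ⟨by omega, hUP _ a (by rw [h2, h3])⟩, h2⟩
    have h1 := (Finset.card_le_card this).trans (Finset.card_insert_le _ _)
    have h2 : (O.image (fun s => W (2 * s + 2))).card ≤ O.card := Finset.card_image_le
    omega
  have hsub : E ⊆ O := by
    intro s hs
    simp only [hE, hO, Finset.mem_filter, Finset.mem_range] at hs ⊢
    refine ⟨hs.1, ?_⟩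
    by_contra hcon
    obtain ⟨a, ha⟩ := hDN _ (by omega) hcon
    have h1 := hs.2
    rw [hUPd] at h1
    rw [ha] at h1
    simp only [List.cons.injEq] at h1
    exact hnb (2 * s) (by omega) (by omega) h1.2
  have hEqO : E = O := Finset.eq_of_subset_of_card_le hsub (by omega)
  have hUD : ∀ s < 2 * j, (UP (2 * s) ↔ UP (2 * s + 1)) := by
    intro s hs
    have : s ∈ E ↔ s ∈ O := by rw [hEqO]
    simpa [hE, hO, hs] using this
  let f : ℕ → Option (ℕ × ℕ) := fun s =>
    if UP (2 * s) then some ((W (2 * s + 1)).headD 0, (W (2 * s + 2)).headD 0) else none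
  have hfs : ∀ s, (f s).isSome = true ↔ UP (2 * s) := by
    intro s; by_cases h : UP (2 * s) <;> simp [f, h]
  have hupc : ∀ s, upc f s = ((Finset.range s).filter (fun s => UP (2 * s))).card := by
    intro s; simp only [upc, hfs]
  have hpos : ∀ s ≤ 2 * j, W (2 * s) = pos f s := by
    intro s
    induction s with
    | zero => intro _; exact h0
    | succ s ih =>
      intro hs
      have e := ih (by omega)
      by_cases h : UP (2 * s)
      · have hf : f s = some ((W (2 * s + 1)).headD 0, (W (2 * s + 2)).headD 0) := by simp [f, h]
        have h' := (hUD s (by omega)).1 h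
        rw [pos_some hf, ← e]
        rw [hUPd] at h h'
        exact h'.trans (congrArg _ h)
      · have hf : f s = none := by simp [f, h]
        have h' := fun h'' => h ((hUD s (by omega)).2 h'')
        obtain ⟨a, ha⟩ := hDN _ (by omega) h
        obtain ⟨b, hb⟩ := hDN _ (by omega) h'
        rw [pos_none hf, ← e, ha, hb]
        rfl
  have hmid : ∀ s < 2 * j, W (2 * s + 1) = mid f s := by
    intro s hs
    have e := hpos s (by omega)
    by_cases h : UP (2 * s)
    · have hf : f s = some ((W (2 * s + 1)).headD 0, (W (2 * s + 2)).headD 0) := by simp [f, h]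
      rw [mid_some hf, ← e]
      exact (hUPd _).1 h
    · have hf : f s = none := by simp [f, h]
      obtain ⟨a, ha⟩ := hDN _ (by omega) h
      rw [mid_none hf, ← e, ha]
      rfl
  refine ⟨f, ?_, ?_, ?_, ?_⟩
  · intro s ab hs hf
    have h : UP (2 * s) := by rw [← hfs, hf]; rfl
    have h1 := hok (2 * s + 1) (by omega)
    have h2 := hok (2 * (s + 1)) (by omega)
    rw [hmid s hs, mid_some hf, ok_cons] at h1
    rw [hpos (s + 1) (by omega), pos_some hf, ok_cons] at h2
    have hp := len_even f s
    have h1' := h1.2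
    have h2' := h2.2
    rw [List.length_cons, if_neg (by omega), if_pos (by omega)] at h2'
    constructor
    · split_ifs at h1' <;> omega
    · exact h2'
  · intro s hs
    have h1 := hlen s hs
    have h2 : ((Finset.range s).filter (fun s => UP (2 * s + 1))) =
        ((Finset.range s).filter (fun s => UP (2 * s))) := by
      apply Finset.filter_congr
      intro i hi
      rw [Finset.mem_range] at hi
      exact (hUD i (by omega)).symm
    rw [h2] at h1
    rw [hupc]
    omega
  · rw [hupc, ← hE]; omega
  · intro t ht
    rcases Nat.even_or_odd' t with ⟨s, rfl | rfl⟩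
    · rw [full_even]; exact hpos s (by omega)
    · rw [full_odd]; exact hmid s (by omega)

theorem good_congr {d1 d2 j : ℕ} {W W' : ℕ → List ℕ} (h : ∀ t ≤ 4 * j, W t = W' t)
    (hW : Good d1 d2 j W) : Good d1 d2 j W' := by
  obtain ⟨hok, h0, hend, hadj, hnb, hc1, hc2⟩ := hW
  refine ⟨?_, ?_, ?_, ?_, ?_, ?_, ?_⟩
  · intro t ht; rw [← h t ht]; exact hok t ht
  · rw [← h 0 (by omega), h0]
  · rw [← h _ le_rfl, hend]
  · intro t ht; rw [← h t (by omega), ← h (t + 1) (by omega)]; exact hadj t ht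
  · intro t ht; rw [← h t (by omega), ← h (t + 2) (by omega)]; exact hnb t ht
  · refine Eq.trans (congrArg Finset.card (Finset.image_congr ?_)) hc1
    intro s hs; simp only [Finset.coe_range, Set.mem_Iio] at hs
    exact (h _ (by omega)).symm
  · refine Eq.trans (congrArg Finset.card (Finset.image_congr ?_)) hc2
    intro s hs; simp only [Finset.coe_range, Set.mem_Iio] at hs
    exact (h _ (by omega)).symm

open DyckStep

theorem count_add (l : List DyckStep) : l.count U + l.count D = l.length := by
  induction l with
  | nil => rfl
  | cons a l ih => cases a <;> simp <;> omega

theorem card_take (l : List DyckStep) (n : ℕ) (hn : n ≤ l.length) :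
    ((Finset.range n).filter (fun s => l[s]? = some U)).card = (l.take n).count U := by
  induction n with
  | zero => simp
  | succ n ih =>
    have := ih (by omega)
    rw [Finset.range_add_one, Finset.filter_insert, List.take_add_one]
    have hl : l[n]? = some l[n] := List.getElem?_eq_getElem (by omega)
    rw [hl]
    rcases hx : l[n] with _ | _ <;> simp [this]

/-- positions of the up steps -/
def ups (p : DyckWord) : Finset ℕ :=
  (Finset.range p.toList.length).filter (fun s => p.toList[s]? = some U)

/-- instructions from a Dyck word and labels -/
def dec (p : DyckWord) (L : ups p → ℕ × ℕ) (s : ℕ) : Option (ℕ × ℕ) :=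
  if h : s ∈ ups p then some (L ⟨s, h⟩) else none

theorem card_ups (p : DyckWord) : (ups p).card = p.semilength := by
  rw [ups, card_take _ _ le_rfl, List.take_length]; rfl

theorem dec_some {p : DyckWord} {L : ups p → ℕ × ℕ} {s : ℕ} {ab : ℕ × ℕ}
    (h : dec p L s = some ab) : ∃ hs : s ∈ ups p, L ⟨s, hs⟩ = ab := by
  unfold dec at h
  split_ifs at h with hs
  exact ⟨hs, by simpa using h⟩

theorem dec_isSome {p : DyckWord} {L : ups p → ℕ × ℕ} {s : ℕ} :
    (dec p L s).isSome = true ↔ s ∈ ups p := by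
  unfold dec; split_ifs with h <;> simp [h]

theorem upc_dec (p : DyckWord) (L : ups p → ℕ × ℕ) (s : ℕ) (hs : s ≤ p.toList.length) :
    upc (dec p L) s = (p.toList.take s).count U := by
  rw [← card_take _ _ hs, upc]
  congr 1
  apply Finset.filter_congr
  intro i hi
  rw [Finset.mem_range] at hi
  rw [dec_isSome, ups, Finset.mem_filter, Finset.mem_range]
  exact ⟨fun h => h.2, fun h => ⟨by omega, h⟩⟩

theorem dyck_dec {p : DyckWord} {L : ups p → ℕ × ℕ} {j : ℕ} (hp : p.semilength = j) :
    (∀ s ≤ 2 * j, s ≤ 2 * upc (dec p L) s) ∧ upc (dec p L) (2 * j) = j := by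
  have hl : p.toList.length = 2 * j := by rw [← p.two_mul_semilength_eq_length, hp]
  constructor
  · intro s hs
    rw [upc_dec p L s (by omega)]
    have h1 := p.count_D_le_count_U s
    have h2 := count_add (p.toList.take s)
    rw [List.length_take] at h2
    omega
  · rw [upc_dec p L _ (by omega), ← hl, List.take_length]; exact hp

theorem word_ext {p q : DyckWord} (hl : p.toList.length = q.toList.length)
    (h : ups p = ups q) : p = q := by
  apply DyckWord.ext
  apply List.ext_getElem hl
  intro s h1 h2
  have : s ∈ ups p ↔ s ∈ ups q := by rw [h]
  simp only [ups, Finset.mem_filter, Finset.mem_range, List.getElem?_eq_getElem h1,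
    List.getElem?_eq_getElem h2, h1, h2, true_and, Option.some.injEq] at this
  rcases hx : p.toList[s] <;> rcases hy : q.toList[s] <;> simp_all

theorem exists_word {f : ℕ → Option (ℕ × ℕ)} {j : ℕ}
    (hD : ∀ s ≤ 2 * j, s ≤ 2 * upc f s) (hj : upc f (2 * j) = j) :
    ∃ p : DyckWord, p.semilength = j ∧
      ∀ s, s ∈ ups p ↔ s < 2 * j ∧ (f s).isSome = true := by
  set l : List DyckStep := (List.range (2 * j)).map (fun s => if (f s).isSome then U else D)
    with hldef
  have hl : l.length = 2 * j := by simp [hldef]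
  have hget : ∀ s, l[s]? = some U ↔ s < 2 * j ∧ (f s).isSome = true := by
    intro s
    by_cases hs : s < 2 * j
    · by_cases h : (f s).isSome = true <;> simp [hldef, hs, h]
    · simp [hldef, hs]
  have hc : ∀ n ≤ 2 * j, (l.take n).count U = upc f n := by
    intro n hn
    rw [← card_take _ _ (by omega), upc]
    congr 1
    apply Finset.filter_congr
    intro i hi
    rw [Finset.mem_range] at hi
    rw [hget]
    exact ⟨fun h => h.2, fun h => ⟨by omega, h⟩⟩
  have hU : l.count U = j := by
    have := hc (2 * j) le_rfl
    rwa [← hl, List.take_length, hl, hj] at this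
  have hadd := count_add l
  refine ⟨⟨l, by omega, ?_⟩, hU, ?_⟩
  · intro i
    by_cases hi : i ≤ 2 * j
    · have h1 := count_add (l.take i)
      rw [List.length_take] at h1
      have h2 := hc i hi
      have h3 := hD i hi
      omega
    · rw [List.take_of_length_le (by omega)]; omega
  · intro s
    simp only [ups, Finset.mem_filter, Finset.mem_range, hget, hl]
    tauto

theorem image_fin (n : ℕ) (g : ℕ → List ℕ) :
    (Finset.univ.image (fun t : Fin n => g t)) = (Finset.range n).image g := by
  ext x
  simp only [Finset.mem_image, Finset.mem_univ, true_and, Finset.mem_range]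
  exact ⟨fun ⟨t, h⟩ => ⟨t, t.2, h⟩, fun ⟨t, ht, h⟩ => ⟨⟨t, ht⟩, h⟩⟩

/-- extension by the root -/
def ext (j : ℕ) (w : Fin (4 * j + 1) → List ℕ) (t : ℕ) : List ℕ :=
  if h : t < 4 * j + 1 then w ⟨t, h⟩ else []

theorem ext_eq {j : ℕ} (w : Fin (4 * j + 1) → List ℕ) {t : ℕ} (h : t < 4 * j + 1) :
    w ⟨t, h⟩ = ext j w t := by simp [ext, h]

theorem card_bounds (d1 d2 j : ℕ) :
    (d1 - j - 1) ^ j * (d2 - 1) ^ j * catalan j ≤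
        Nat.card {w : Fin (4 * j + 1) → List ℕ // Good d1 d2 j (ext j w)} ∧
      Nat.card {w : Fin (4 * j + 1) → List ℕ // Good d1 d2 j (ext j w)} ≤
        d1 ^ j * (d2 - 1) ^ j * catalan j := by
  classical
  let X := Σ p : {p : DyckWord // p.semilength = j}, (ups p.1 → Fin d1 × Fin (d2 - 1))
  let F : X → Fin (4 * j + 1) → List ℕ := fun x t =>
    full (dec x.1.1 (fun s => ((x.2 s).1.val, (x.2 s).2.val))) t
  have hsub : {w | Good d1 d2 j (ext j w)} ⊆ Set.range F := by
    intro w hw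
    obtain ⟨f, h1, h2, h3, h4⟩ := exists_instr hw
    obtain ⟨p, hp, hup⟩ := exists_word h2 h3
    have hlab : ∀ s : ups p, ∃ ab : Fin d1 × Fin (d2 - 1), f s = some (ab.1.val, ab.2.val) := by
      intro s
      obtain ⟨hs, hs'⟩ := (hup s).1 s.2
      obtain ⟨ab, hab⟩ := Option.isSome_iff_exists.1 hs'
      obtain ⟨ha, hb⟩ := h1 s ab hs hab
      exact ⟨(⟨ab.1, ha⟩, ⟨ab.2, hb⟩), hab⟩
    choose L hL using hlab
    refine ⟨⟨⟨p, hp⟩, L⟩, ?_⟩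
    have hdec : ∀ s < 2 * j, dec p (fun s => ((L s).1.val, (L s).2.val)) s = f s := by
      intro s hs
      unfold dec
      split_ifs with h
      · exact (hL ⟨s, h⟩).symm
      · rw [hup] at h
        rcases hf : f s with _ | ab
        · rfl
        · exact absurd ⟨hs, by simp [hf]⟩ h
    have hpos : ∀ s ≤ 2 * j, pos (dec p (fun s => ((L s).1.val, (L s).2.val))) s = pos f s := by
      intro s
      induction s with
      | zero => intro _; rfl
      | succ s ih => intro hs; rw [pos, pos, hdec s (by omega), ih (by omega)]
    funext t
    have ht := t.2
    rw [show w t = ext j w t from ext_eq w t.2, h4 t (by omega)]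
    simp only [F]
    rcases Nat.even_or_odd' (t : ℕ) with ⟨s, hs | hs⟩
    · rw [hs, full_even, full_even, hpos s (by omega)]
    · rw [hs, full_odd, full_odd, mid, mid, hdec s (by omega), hpos s (by omega)]
  have hfin : {w | Good d1 d2 j (ext j w)}.Finite := (Set.finite_range F).subset hsub
  constructor
  · let Y := Σ p : {p : DyckWord // p.semilength = j},
      ((ups p.1 ↪ Fin (d1 - 1)) × (ups p.1 → Fin (d2 - 1)))
    have hY : Nat.card Y = (d1 - 1).descFactorial j * (d2 - 1) ^ j * catalan j := by
      rw [Nat.card_eq_fintype_card, Fintype.card_sigma,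
        Finset.sum_congr rfl (g := fun _ => (d1 - 1).descFactorial j * (d2 - 1) ^ j)]
      · rw [Finset.sum_const, Finset.card_univ, DyckWord.card_dyckWord_semilength_eq_catalan,
          smul_eq_mul, mul_comm]
      · intro p _
        rw [Fintype.card_prod, Fintype.card_embedding_eq, Fintype.card_fun]
        simp [card_ups, p.2]
    let g : Y → ℕ → Option (ℕ × ℕ) := fun y =>
      dec y.1.1 (fun s => ((y.2.1 s).val, (y.2.2 s).val))
    have hg : ∀ y, Good d1 d2 j (full (g y)) := by
      rintro ⟨p, e, b⟩
      obtain ⟨h1, h2⟩ := dyck_dec (L := fun s => ((e s).val, (b s).val)) p.2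
      refine good_full ?_ ?_ h1 h2
      · intro s ab h
        obtain ⟨hs, rfl⟩ := dec_some h
        exact ⟨(e _).2, (b _).2⟩
      · intro s s' ab ab' h h' heq
        obtain ⟨hs, rfl⟩ := dec_some h
        obtain ⟨hs', rfl⟩ := dec_some h'
        have := e.injective (Fin.ext heq)
        simpa using this
    let G : Y → {w : Fin (4 * j + 1) → List ℕ // Good d1 d2 j (ext j w)} := fun y =>
      ⟨fun t => full (g y) t, good_congr (by
        intro t ht; rw [← ext_eq _ (by omega)]) (hg y)⟩
    have hG : Function.Injective G := by
      rintro ⟨⟨p, hp⟩, e, b⟩ ⟨⟨q, hq⟩, e', b'⟩ h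
      have h1 := congrArg Subtype.val h
      have h2 := full_inj (n := 2 * j) (fun t ht => congrFun h1 ⟨t, by omega⟩)
      simp only [g] at h2
      have hlp : p.toList.length = 2 * j := by rw [← p.two_mul_semilength_eq_length, hp]
      have hlq : q.toList.length = 2 * j := by rw [← q.two_mul_semilength_eq_length, hq]
      have hlt : ∀ s ∈ ups p, s < 2 * j := by
        intro s hs; simp only [ups, Finset.mem_filter, Finset.mem_range] at hs; omega
      have hlt' : ∀ s ∈ ups q, s < 2 * j := by
        intro s hs; simp only [ups, Finset.mem_filter, Finset.mem_range] at hs; omega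
      have hpq : p = q := by
        apply word_ext (by omega)
        ext s
        constructor
        · intro hs
          have := h2 s (hlt s hs)
          rw [← dec_isSome, this, dec_isSome] at hs
          exact hs
        · intro hs
          have := h2 s (hlt' s hs)
          rw [← dec_isSome, ← this, dec_isSome] at hs
          exact hs
      subst hpq
      have h3 : ∀ s : ups p, e s = e' s ∧ b s = b' s := by
        intro s
        have := h2 s (hlt s s.2)
        simp only [dec, s.2, dif_pos, Option.some.injEq, Prod.mk.injEq] at this
        exact ⟨Fin.ext this.1, Fin.ext this.2⟩
      have he : e = e' := by ext s; exact congrArg Fin.val (h3 s).1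
      have hb : b = b' := by funext s; exact (h3 s).2
      rw [he, hb]
    have : Finite {w : Fin (4 * j + 1) → List ℕ // Good d1 d2 j (ext j w)} := hfin
    have := Nat.card_le_card_of_injective G hG
    rw [hY] at this
    refine le_trans ?_ this
    gcongr
    rcases Nat.eq_zero_or_pos d1 with h | h
    · subst h
      rcases j with _ | j
      · simp
      · simp
    · refine le_trans ?_ (Nat.pow_sub_le_descFactorial (d1 - 1) j)
      exact Nat.pow_le_pow_left (by omega) j
  · have hX : Nat.card X = d1 ^ j * (d2 - 1) ^ j * catalan j := by
      rw [Nat.card_eq_fintype_card, Fintype.card_sigma,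
        Finset.sum_congr rfl (g := fun _ => d1 ^ j * (d2 - 1) ^ j)]
      · rw [Finset.sum_const, Finset.card_univ, DyckWord.card_dyckWord_semilength_eq_catalan,
          smul_eq_mul, mul_comm]
      · intro p _
        rw [Fintype.card_fun]
        simp [card_ups, p.2, mul_pow]
    rw [← hX]
    have h1 : Nat.card {w : Fin (4 * j + 1) → List ℕ // Good d1 d2 j (ext j w)} =
      {w | Good d1 d2 j (ext j w)}.ncard := rfl
    rw [h1]
    refine (Set.ncard_le_ncard hsub (Set.finite_range F)).trans ?_
    rw [← Set.image_univ, ← Set.ncard_univ]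
    exact Set.ncard_image_le Set.finite_univ
end BT

/-- The number `A_k^{k/2+1,k/2}` (with `k = 2j` even) of closed walks of length `2k = 4j`
on the (d1,d2)-biregular tree starting and ending at the root, which never immediately
backtrack at even depths (after moving from a V1-vertex to a V2-vertex the walk does not
return to the same V1-vertex), and which use exactly `j + 1` distinct V1-vertices and
`j` distinct V2-vertices, satisfies
`(d1 - j - 1)^j (d2-1)^j · Cat(j) ≤ A ≤ d1^j (d2-1)^j · Cat(j)`. -/
theorem stmt_16 (d1 d2 j : ℕ) (hd1 : 2 ≤ d1) (hd2 : 2 ≤ d2) :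
    ∀ N : ℕ,
      N = Nat.card {w : Fin (4 * j + 1) → List ℕ //
        (∀ t, okList d1 d2 (w t)) ∧
        w ⟨0, by omega⟩ = [] ∧ w ⟨4 * j, by omega⟩ = [] ∧
        (∀ (t : ℕ) (h : t < 4 * j),
          (∃ a, w ⟨t + 1, by omega⟩ = a :: w ⟨t, by omega⟩) ∨
          (∃ a, w ⟨t, by omega⟩ = a :: w ⟨t + 1, by omega⟩)) ∧
        (∀ (t : ℕ) (h : t + 2 ≤ 4 * j), t % 2 = 0 →
          w ⟨t + 2, by omega⟩ ≠ w ⟨t, by omega⟩) ∧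
        (Finset.univ.image
          (fun t : Fin (2 * j + 1) => w ⟨2 * t, by have := t.isLt; omega⟩)).card = j + 1 ∧
        (Finset.univ.image
          (fun t : Fin (2 * j) => w ⟨2 * t + 1, by have := t.isLt; omega⟩)).card = j} →
      (d1 - j - 1) ^ j * (d2 - 1) ^ j * catalan j ≤ N ∧
        N ≤ d1 ^ j * (d2 - 1) ^ j * catalan j := by
  rintro N rfl
  have key : ∀ w : Fin (4 * j + 1) → List ℕ, BT.Good d1 d2 j (BT.ext j w) ↔
      ((∀ t, okList d1 d2 (w t)) ∧
        w ⟨0, by omega⟩ = [] ∧ w ⟨4 * j, by omega⟩ = [] ∧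
        (∀ (t : ℕ) (h : t < 4 * j),
          (∃ a, w ⟨t + 1, by omega⟩ = a :: w ⟨t, by omega⟩) ∨
          (∃ a, w ⟨t, by omega⟩ = a :: w ⟨t + 1, by omega⟩)) ∧
        (∀ (t : ℕ) (h : t + 2 ≤ 4 * j), t % 2 = 0 →
          w ⟨t + 2, by omega⟩ ≠ w ⟨t, by omega⟩) ∧
        (Finset.univ.image
          (fun t : Fin (2 * j + 1) => w ⟨2 * t, by have := t.isLt; omega⟩)).card = j + 1 ∧
        (Finset.univ.image
          (fun t : Fin (2 * j) => w ⟨2 * t + 1, by have := t.isLt; omega⟩)).card = j) := by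
    intro w
    simp only [BT.ext_eq w]
    rw [BT.image_fin (2 * j + 1) (fun s => BT.ext j w (2 * s)),
      BT.image_fin (2 * j) (fun s => BT.ext j w (2 * s + 1))]
    have h1 : (∀ t : Fin (4 * j + 1), okList d1 d2 (BT.ext j w t)) ↔ ∀ t ≤ 4 * j, okList d1 d2 (BT.ext j w t) := by
      constructor
      · intro h t ht
        exact h ⟨t, by omega⟩
      · intro h t
        have ht := t.isLt
        exact h t (by omega)
    rw [h1]
    exact Iff.rfl
  have := BT.card_bounds d1 d2 j
  rw [Nat.card_congr (Equiv.subtypeEquivRight key)] at this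
  exact this
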